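/- The set 𝓔̃ coincides with the set {α ∈ [g,1] : T_g^n(α−1) ≥ α−1 and T_g^n(1/α − 1) ≥ α−1 for all n ≥ 1}, where T_g is the Tanaka–Ito map with parameter g. -/

import Mathlib

open Set Filter MeasureTheory

/-- The Tanaka–Ito `α`-continued fraction map. -/
noncomputable def T (α x : ℝ) : ℝ := if x = 0 then 0 else 1 / x - (⌊1 / x + 1 - α⌋ : ℝ)

/-- The small golden mean `g = (√5 - 1)/2`. -/
noncomputable def g : ℝ := (Real.sqrt 5 - 1) / 2

/-- The set `𝓔̃` of parameters in `[g,1]` whose orbits stay below `1/(α+1)`. -/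
noncomputable def Etilde : Set ℝ :=
  {α ∈ Set.Icc g 1 | ∀ n ≥ 1,
    (T α)^[n] (α - 1) ≤ 1 / (α + 1) ∧ (T α)^[n] (1 / α - 1) ≤ 1 / (α + 1)}

theorem g_pos : 0 < g := by
  have h : (1 : ℝ) < Real.sqrt 5 := by
    rw [Real.lt_sqrt] <;> norm_num
  unfold g
  linarith

theorem g_mul_g_add_one : g * (g + 1) = 1 := by
  have h : Real.sqrt 5 * Real.sqrt 5 = 5 := Real.mul_self_sqrt (by norm_num)
  unfold g
  linarith

theorem T_of_ne_zero {x : ℝ} (hx : x ≠ 0) (α : ℝ) :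
    T α x = 1 / x - (⌊1 / x + 1 - α⌋ : ℝ) := by
  simp [T, hx]

theorem T_zero (α : ℝ) : T α 0 = 0 := by
  simp [T]

theorem T_lt {α : ℝ} (hα : 0 < α) (x : ℝ) : T α x < α := by
  by_cases hx : x = 0
  · rwa [hx, T_zero]
  · rw [T_of_ne_zero hx]
    linarith [Int.lt_floor_add_one (1 / x + 1 - α)]

theorem sub_one_le_T {α : ℝ} (hα : α ≤ 1) (x : ℝ) : α - 1 ≤ T α x := by
  by_cases hx : x = 0
  · rw [hx, T_zero]
    linarith
  · rw [T_of_ne_zero hx]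
    linarith [Int.floor_le (1 / x + 1 - α)]

/-- Two Tanaka–Ito maps agree at `x` as soon as the value of the first lies in the range of the
second. -/
theorem T_eq_of_mem_Ico {α β x : ℝ} (h : T α x ∈ Set.Ico (β - 1) β) : T β x = T α x := by
  by_cases hx : x = 0
  · rw [hx, T_zero, T_zero]
  · rw [T_of_ne_zero hx] at h ⊢
    rw [T_of_ne_zero hx]
    have hfloor : ⌊1 / x + 1 - β⌋ = ⌊1 / x + 1 - α⌋ := by
      rw [Int.floor_eq_iff]
      constructor <;> linarith [h.1, h.2]
    rw [hfloor]

/-- If the orbit of `x` under `T α` stays in the range of `T β`, then `x` has the same orbit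
under both maps. -/
theorem iterate_T_eq {α β x : ℝ} (h : ∀ n ≥ 1, (T α)^[n] x ∈ Set.Ico (β - 1) β) (n : ℕ) :
    (T β)^[n] x = (T α)^[n] x := by
  induction n with
  | zero => rfl
  | succ n ih =>
    have hn := h (n + 1) (by omega)
    rw [Function.iterate_succ_apply'] at hn
    rw [Function.iterate_succ_apply', Function.iterate_succ_apply', ih]
    exact T_eq_of_mem_Ico hn

theorem iterate_T_mem_Ico {α : ℝ} (h0 : 0 < α) (h1 : α ≤ 1) (x : ℝ) {n : ℕ} (hn : 1 ≤ n) :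
    (T α)^[n] x ∈ Set.Ico (α - 1) α := by
  obtain ⟨m, rfl⟩ := Nat.exists_eq_add_of_le' hn
  rw [Function.iterate_succ_apply']
  exact ⟨sub_one_le_T h1 _, T_lt h0 _⟩

theorem T_g_lt_of_mem_Ioo {α y : ℝ} (hα : α ∈ Set.Icc g 1) (hy : 1 / (α + 1) < y) (hyg : y < g) :
    T g y < α - 1 := by
  have hg := g_pos
  have hα0 : 0 < α + 1 := by linarith [hα.1]
  have hy0 : 0 < y := lt_trans (by positivity) hy
  have hlt : 1 / y < α + 1 := (one_div_lt hα0 hy0).1 hy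
  have hge : g + 1 < 1 / y := by
    rw [lt_div_iff₀ hy0]
    nlinarith [g_mul_g_add_one]
  have hfloor : ⌊1 / y + 1 - g⌋ = 2 := by
    rw [Int.floor_eq_iff]
    constructor <;> push_cast <;> linarith [hα.2]
  rw [T_of_ne_zero hy0.ne', hfloor]
  push_cast
  linarith

theorem forall_iterate_T_le_iff {α : ℝ} (hα : α ∈ Set.Icc g 1) (x : ℝ) :
    (∀ n ≥ 1, (T α)^[n] x ≤ 1 / (α + 1)) ↔ ∀ n ≥ 1, α - 1 ≤ (T g)^[n] x := by
  have hg := g_pos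
  have hα0 : 0 < α := hg.trans_le hα.1
  have hg1 : g ≤ 1 := hα.1.trans hα.2
  constructor
  · intro h n hn
    have hmem : ∀ n ≥ 1, (T α)^[n] x ∈ Set.Ico (g - 1) g := by
      intro n hn
      have hI := iterate_T_mem_Ico hα0 hα.2 x hn
      refine ⟨by linarith [hI.1, hα.1], ?_⟩
      rcases hα.1.eq_or_lt with heq | hlt
      · exact heq ▸ hI.2
      · refine (h n hn).trans_lt ?_
        rw [div_lt_iff₀ (by linarith)]
        nlinarith [g_mul_g_add_one]
    rw [iterate_T_eq hmem]
    exact (iterate_T_mem_Ico hα0 hα.2 x hn).1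
  · intro h n hn
    have hlt : ∀ n ≥ 1, (T g)^[n] x < g := fun n hn => (iterate_T_mem_Ico hg hg1 x hn).2
    rw [iterate_T_eq fun n hn => ⟨h n hn, (hlt n hn).trans_le hα.1⟩]
    by_contra! hcon
    have hnext := h (n + 1) (by omega)
    rw [Function.iterate_succ_apply'] at hnext
    linarith [T_g_lt_of_mem_Ioo hα hcon (hlt n hn)]

theorem stmt6 :
    Etilde = {α ∈ Set.Icc g 1 | ∀ n ≥ 1,
      α - 1 ≤ (T g)^[n] (α - 1) ∧ α - 1 ≤ (T g)^[n] (1 / α - 1)} := by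
  ext α
  refine and_congr_right fun hα => ?_
  simp only [forall_and, forall_iterate_T_le_iff hα]
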